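/- Fix integers G ≥ 2 and R ≥ 1 and positive reals k_on, k_1, …, k_G. Then FF^C(R, 0) = 1 − (1 − (2R−1)!!/(2R)!!) · 2 e_G(k_1,…,k_G) e_{G−2}(k_1,…,k_G)/e_{G−1}(k_1,…,k_G)², and FF^C(R, 0) ≥ 1/G + (1 − 1/G) · (2R−1)!!/(2R)!!, with equality if and only if k_1 = k_2 = … = k_G. -/

import Mathlib

/-- Elementary symmetric polynomial of (integer) degree `g` in the variables
`x i` for `i ∈ s`, with the conventions `e_0 = 1` and `e_g = 0` for `g < 0`
or `g > card s`. -/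
noncomputable def esymm (x : ℕ → ℝ) (s : Finset ℕ) (g : ℤ) : ℝ :=
  if 0 ≤ g then ∑ t ∈ s.powersetCard g.toNat, ∏ i ∈ t, x i else 0

/-- Double factorial: `dfact n = n!! = n(n−2)(n−4)⋯`, with `0!! = 1!! = 1`. -/
def dfact : ℕ → ℕ
  | 0 => 1
  | 1 => 1
  | n + 2 => (n + 2) * dfact n

/-- Fano factor of total cytoplasmic mRNA from the slow-scale linear noise
approximation, with `R` cytoplasmic processing steps. -/
noncomputable def FFC (G : ℕ) (k : ℕ → ℝ) (kon koff : ℝ) (R : ℕ) : ℝ :=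
  1 + 2 * esymm k (Finset.Icc 1 G) (G : ℤ) *
      (1 - (dfact (2 * R - 1) : ℝ) / (dfact (2 * R) : ℝ)) *
      (koff * esymm k (Finset.Icc 2 G) ((G : ℤ) - 1)
        - kon * koff * esymm k (Finset.Icc 2 G) ((G : ℤ) - 2)
        - kon ^ 2 * esymm k (Finset.Icc 1 G) ((G : ℤ) - 2)) /
      (koff * esymm k (Finset.Icc 2 G) ((G : ℤ) - 1)
        + kon * esymm k (Finset.Icc 1 G) ((G : ℤ) - 1)) ^ 2

lemma aux_E (k : ℕ → ℝ) (s : Finset ℕ) : (∀ i ∈ s, 0 < k i) →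
    (∀ g, g + 1 = s.card → ∑ t ∈ s.powersetCard g, ∏ i ∈ t, k i
      = (∏ i ∈ s, k i) * ∑ i ∈ s, (k i)⁻¹) ∧
    (∀ g, g + 2 = s.card → 2 * ∑ t ∈ s.powersetCard g, ∏ i ∈ t, k i
      = (∏ i ∈ s, k i) * ((∑ i ∈ s, (k i)⁻¹) ^ 2 - ∑ i ∈ s, (k i)⁻¹ ^ 2)) := by
  induction s using Finset.induction_on with
  | empty => intro _; simp
  | insert a s ha ih =>
    intro hp
    have hpa : 0 < k a := hp a (by simp)
    have hne : k a ≠ 0 := hpa.ne'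
    obtain ⟨h1, h2⟩ := ih (fun i hi => hp i (by simp [hi]))
    have rec1 : ∀ h, ∑ t ∈ (insert a s).powersetCard (h + 1), ∏ i ∈ t, k i
        = ∑ t ∈ s.powersetCard (h + 1), ∏ i ∈ t, k i
          + k a * ∑ t ∈ s.powersetCard h, ∏ i ∈ t, k i := by
      intro h
      have hn : ∀ t ∈ s.powersetCard h, a ∉ t := fun t ht hat =>
        ha ((Finset.mem_powersetCard.1 ht).1 hat)
      rw [Finset.powersetCard_succ_insert ha, Finset.sum_union, Finset.sum_image, Finset.mul_sum]
      · congr 1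
        exact Finset.sum_congr rfl fun t ht => Finset.prod_insert (hn t ht)
      · intro t ht u hu htu
        have := congrArg (fun w => w.erase a) htu
        simpa [Finset.erase_insert (hn t ht), Finset.erase_insert (hn u hu)] using this
      · rw [Finset.disjoint_left]
        intro t ht ht'
        obtain ⟨u, _, rfl⟩ := Finset.mem_image.1 ht'
        exact ha ((Finset.mem_powersetCard.1 ht).1 (by simp))
    rw [Finset.card_insert_of_notMem ha, Finset.prod_insert ha, Finset.sum_insert ha,
      Finset.sum_insert ha]
    constructor
    · rintro g hg
      obtain rfl | ⟨h, rfl⟩ : g = 0 ∨ ∃ h, g = h + 1 := by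
        cases g <;> simp
      · have : s = ∅ := Finset.card_eq_zero.1 (by omega)
        subst this
        simp [hne]
      · rw [rec1, h1 h (by omega)]
        have : h + 1 = s.card := by omega
        rw [this, Finset.powersetCard_self]
        simp only [Finset.sum_singleton]
        field_simp
    · rintro g hg
      obtain rfl | ⟨h, rfl⟩ : g = 0 ∨ ∃ h, g = h + 1 := by
        cases g <;> simp
      · obtain ⟨b, rfl⟩ := Finset.card_eq_one.1 (show s.card = 1 by omega)
        have hb : k b ≠ 0 := (hp b (by simp)).ne'
        simp
        field_simp
        ring
      · rw [rec1, mul_add, h1 (h + 1) (by omega), mul_left_comm 2 (k a), h2 h (by omega)]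
        field_simp
        ring

lemma aux_dfact_pos : ∀ n, 0 < dfact n
  | 0 => by simp [dfact]
  | 1 => by simp [dfact]
  | n + 2 => by
    have := aux_dfact_pos n
    simp only [dfact]
    positivity

lemma aux_dfact_lt (m : ℕ) : dfact (2 * m + 1) < dfact (2 * m + 2) := by
  induction m with
  | zero => simp [dfact]
  | succ m ih =>
    have e1 : dfact (2 * (m + 1) + 1) = (2 * m + 1 + 2) * dfact (2 * m + 1) := rfl
    have e2 : dfact (2 * (m + 1) + 2) = (2 * m + 2 + 2) * dfact (2 * m + 2) := rfl
    rw [e1, e2]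
    exact Nat.mul_lt_mul_of_lt_of_le (by omega) ih.le (aux_dfact_pos _)

/-- value of the cytoplasmic Fano factor at `koff = 0` and its
lower bound `1/G + (1 − 1/G)·(2R−1)!!/(2R)!!`, attained exactly when all the
initiation rates are equal. -/
theorem FFC_at_koff_zero_lower_bound
    (G R : ℕ) (hG : 2 ≤ G) (hR : 1 ≤ R)
    (kon : ℝ) (k : ℕ → ℝ) (hkon : 0 < kon)
    (hk : ∀ i ∈ Finset.Icc 1 G, 0 < k i) :
    FFC G k kon 0 R =
      1 - (1 - (dfact (2 * R - 1) : ℝ) / (dfact (2 * R) : ℝ)) *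
        2 * esymm k (Finset.Icc 1 G) (G : ℤ) *
          esymm k (Finset.Icc 1 G) ((G : ℤ) - 2) /
          esymm k (Finset.Icc 1 G) ((G : ℤ) - 1) ^ 2 ∧
    1 / (G : ℝ) + (1 - 1 / (G : ℝ)) * ((dfact (2 * R - 1) : ℝ) / (dfact (2 * R) : ℝ)) ≤
      FFC G k kon 0 R ∧
    (FFC G k kon 0 R =
        1 / (G : ℝ) + (1 - 1 / (G : ℝ)) * ((dfact (2 * R - 1) : ℝ) / (dfact (2 * R) : ℝ)) ↔
      ∀ i ∈ Finset.Icc 1 G, ∀ j ∈ Finset.Icc 1 G, k i = k j) := by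
  have hr : (dfact (2 * R - 1) : ℝ) / (dfact (2 * R) : ℝ) < 1 := by
    obtain ⟨m, rfl⟩ : ∃ m, R = m + 1 := ⟨R - 1, by omega⟩
    rw [div_lt_one (by exact_mod_cast aux_dfact_pos _)]
    exact_mod_cast aux_dfact_lt m
  unfold FFC
  generalize (dfact (2 * R - 1) : ℝ) / (dfact (2 * R) : ℝ) = r at *
  obtain ⟨h1, h2⟩ := aux_E k (Finset.Icc 1 G) hk
  have hc : (Finset.Icc 1 G).card = G := by simp
  have e0 : esymm k (Finset.Icc 1 G) (G : ℤ) = ∏ i ∈ Finset.Icc 1 G, k i := by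
    have : Finset.powersetCard G (Finset.Icc 1 G) = {Finset.Icc 1 G} := by
      have h := Finset.powersetCard_self (Finset.Icc 1 G)
      rwa [hc] at h
    simp [esymm, this]
  have e1 : esymm k (Finset.Icc 1 G) ((G : ℤ) - 1) =
      (∏ i ∈ Finset.Icc 1 G, k i) * ∑ i ∈ Finset.Icc 1 G, (k i)⁻¹ := by
    rw [← h1 (G - 1) (by rw [hc]; omega), esymm, if_pos (by omega)]
    congr 2
    omega
  have e2 : 2 * esymm k (Finset.Icc 1 G) ((G : ℤ) - 2) =
      (∏ i ∈ Finset.Icc 1 G, k i) * ((∑ i ∈ Finset.Icc 1 G, (k i)⁻¹) ^ 2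
        - ∑ i ∈ Finset.Icc 1 G, (k i)⁻¹ ^ 2) := by
    rw [← h2 (G - 2) (by rw [hc]; omega), esymm, if_pos (by omega)]
    congr 3
    omega
  have hP : 0 < ∏ i ∈ Finset.Icc 1 G, k i := Finset.prod_pos hk
  have hS : 0 < ∑ i ∈ Finset.Icc 1 G, (k i)⁻¹ :=
    Finset.sum_pos (fun i hi => inv_pos.2 (hk i hi)) ⟨1, by simp; omega⟩
  have hid : ∑ i ∈ Finset.Icc 1 G, ((G : ℝ) * (k i)⁻¹ - ∑ i ∈ Finset.Icc 1 G, (k i)⁻¹) ^ 2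
      = G * (G * ∑ i ∈ Finset.Icc 1 G, (k i)⁻¹ ^ 2 - (∑ i ∈ Finset.Icc 1 G, (k i)⁻¹) ^ 2) := by
    generalize hT : ∑ i ∈ Finset.Icc 1 G, (k i)⁻¹ = S
    have : ∀ i, ((G : ℝ) * (k i)⁻¹ - S) ^ 2
        = (G : ℝ) ^ 2 * (k i)⁻¹ ^ 2 - 2 * G * S * (k i)⁻¹ + S ^ 2 := fun i => by ring
    simp only [this, Finset.sum_add_distrib, Finset.sum_sub_distrib, ← Finset.mul_sum, hT,
      Finset.sum_const, hc, nsmul_eq_mul]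
    ring
  have hGp : (0 : ℝ) < G := by exact_mod_cast (by omega : 0 < G)
  have hnn : 0 ≤ ∑ i ∈ Finset.Icc 1 G,
      ((G : ℝ) * (k i)⁻¹ - ∑ i ∈ Finset.Icc 1 G, (k i)⁻¹) ^ 2 :=
    Finset.sum_nonneg fun i _ => sq_nonneg _
  have heq : (G * ∑ i ∈ Finset.Icc 1 G, (k i)⁻¹ ^ 2 - (∑ i ∈ Finset.Icc 1 G, (k i)⁻¹) ^ 2 = 0) ↔
      ∀ i ∈ Finset.Icc 1 G, ∀ j ∈ Finset.Icc 1 G, k i = k j := by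
    constructor
    · intro h
      rw [h, mul_zero, Finset.sum_eq_zero_iff_of_nonneg (fun i _ => sq_nonneg _)] at hid
      intro i hi j hj
      have a := pow_eq_zero_iff (two_ne_zero) |>.1 (hid i hi)
      have b := pow_eq_zero_iff (two_ne_zero) |>.1 (hid j hj)
      have : (G : ℝ) * (k i)⁻¹ = G * (k j)⁻¹ := by linarith
      exact inv_injective (mul_left_cancel₀ hGp.ne' this)
    · intro h
      have h1' : ∀ i ∈ Finset.Icc 1 G, k i = k 1 := fun i hi => h i hi 1 (by simp; omega)
      have q1 : ∑ i ∈ Finset.Icc 1 G, (k i)⁻¹ = ∑ i ∈ Finset.Icc 1 G, (k 1)⁻¹ :=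
        Finset.sum_congr rfl (fun i hi => by rw [h1' i hi])
      have q2 : ∑ i ∈ Finset.Icc 1 G, (k i)⁻¹ ^ 2 = ∑ i ∈ Finset.Icc 1 G, (k 1)⁻¹ ^ 2 :=
        Finset.sum_congr rfl (fun i hi => by rw [h1' i hi])
      rw [q1, q2]
      simp
      ring
  rw [hid] at hnn
  have hnn' := nonneg_of_mul_nonneg_right hnn hGp
  clear hid hnn h1 h2
  rw [e0, e1]
  have e2' : esymm k (Finset.Icc 1 G) ((G : ℤ) - 2) =
      (∏ i ∈ Finset.Icc 1 G, k i) * ((∑ i ∈ Finset.Icc 1 G, (k i)⁻¹) ^ 2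
        - ∑ i ∈ Finset.Icc 1 G, (k i)⁻¹ ^ 2) / 2 := by linarith
  rw [e2', ← heq]
  clear heq e2' e2 e1 e0
  simp only [zero_mul, mul_zero, zero_add, zero_sub, sub_zero]
  generalize ∏ i ∈ Finset.Icc 1 G, k i = P at *
  generalize ∑ i ∈ Finset.Icc 1 G, (k i)⁻¹ = S at *
  generalize ∑ i ∈ Finset.Icc 1 G, (k i)⁻¹ ^ 2 = Q at *
  have hr' : 0 < 1 - r := by linarith
  have key : 1 + 2 * P * (1 - r) * (-(kon ^ 2 * (P * (S ^ 2 - Q) / 2))) / (kon * (P * S)) ^ 2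
      = (1 / (G : ℝ) + (1 - 1 / (G : ℝ)) * r) + (1 - r) / (G * S ^ 2) * (G * Q - S ^ 2) := by
    field_simp
    ring
  have hpos : 0 < (1 - r) / (G * S ^ 2) := by positivity
  refine ⟨?_, ?_, ?_⟩
  · field_simp
    ring
  · rw [key]
    have := mul_nonneg hpos.le hnn'
    linarith
  · rw [key, add_eq_left, mul_eq_zero]
    simp [hpos.ne']
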